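/- Let T be an arbitrary triangle and k ≥ 3. A function ξ in the virtual element space 𝒱^k(T) is uniquely determined by its trace Tr ξ ∈ (H^2×H^1)_{k,k−1}(∂T) and by the projection Q_{T,k−4}ξ ∈ P_{k−4}(T). -/

import Mathlib

open MeasureTheory Real Set
open scoped RealInnerProductSpace
noncomputable section

abbrev E2 := EuclideanSpace ℝ (Fin 2)
def stdb2 (i : Fin 2) : E2 := EuclideanSpace.single i 1
def L2on {n : ℕ} (Ω : Set (EuclideanSpace ℝ (Fin n))) (u : EuclideanSpace ℝ (Fin n) → ℝ) : Prop :=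
  MemLp u 2 (volume.restrict Ω)
def IsWeakD {n : ℕ} (Ω : Set (EuclideanSpace ℝ (Fin n)))
    (u v : EuclideanSpace ℝ (Fin n) → ℝ) (d : EuclideanSpace ℝ (Fin n)) : Prop :=
  ∀ φ : EuclideanSpace ℝ (Fin n) → ℝ, ContDiff ℝ (⊤ : ℕ∞) φ → HasCompactSupport φ → tsupport φ ⊆ Ω →
    ∫ x in Ω, u x * fderiv ℝ φ x d = - ∫ x in Ω, v x * φ x
def tri (p : Fin 3 → E2) : Set E2 := interior (convexHull ℝ (range p))
def evec (p : Fin 3 → E2) (i : Fin 3) : E2 := p (i + 2) - p (i + 1)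
def elen (p : Fin 3 → E2) (i : Fin 3) : ℝ := ‖evec p i‖
def tangv (p : Fin 3 → E2) (i : Fin 3) : E2 := (elen p i)⁻¹ • evec p i
def norv (p : Fin 3 → E2) (i : Fin 3) : E2 :=
  EuclideanSpace.single 0 (tangv p i 1) + EuclideanSpace.single 1 (-(tangv p i 0))
def epar (p : Fin 3 → E2) (i : Fin 3) (t : ℝ) : E2 := p (i + 1) + t • evec p i
def ccw (p : Fin 3 → E2) : Prop :=
  0 < (p 1 - p 0) 0 * (p 2 - p 0) 1 - (p 1 - p 0) 1 * (p 2 - p 0) 0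
def tau (i j : Fin 3) : ℝ := if i = j + 1 then 0 else 1

/-- weak derivative on an open interval of `ℝ` -/
def IsWeakD1 (S : Set ℝ) (u v : ℝ → ℝ) : Prop :=
  ∀ φ : ℝ → ℝ, ContDiff ℝ (⊤ : ℕ∞) φ → HasCompactSupport φ → tsupport φ ⊆ S →
    ∫ t in S, u t * deriv φ t = - ∫ t in S, v t * φ t

def MemHedge : ℕ → (ℝ → ℝ) → Prop
  | 0, u => MemLp u 2 (volume.restrict (Ioo (0:ℝ) 1))
  | (k+1), u => MemLp u 2 (volume.restrict (Ioo (0:ℝ) 1)) ∧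
      ∃ v, IsWeakD1 (Ioo (0:ℝ) 1) u v ∧ MemHedge k v

/-- membership of edgewise data in `H²(∂T) × H¹(∂T)` (with pointwise C¹/C⁰ representatives) -/
def MemBdryH2H1 (f g : Fin 3 → ℝ → ℝ) : Prop :=
  ∀ i, MemHedge 2 (f i) ∧ ContDiffOn ℝ 1 (f i) (Icc 0 1) ∧
    MemHedge 1 (g i) ∧ ContinuousOn (g i) (Icc 0 1)

/-- compatibility conditions (2.2)-(2.4) -/
def Compat (p : Fin 3 → E2) (f g : Fin 3 → ℝ → ℝ) : Prop :=
  (∀ i j k : Fin 3, j ≠ i → k ≠ i → f j (tau i j) = f k (tau i k)) ∧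
  ∃ w : Fin 3 → E2, ∀ i j : Fin 3, j ≠ i →
    derivWithin (f j) (Icc 0 1) (tau i j) = elen p j * ⟪w i, tangv p j⟫ ∧
    g j (tau i j) = ⟪w i, norv p j⟫

/-- `H²` membership with explicit weak gradient and Hessian data -/
def MemH2W {n : ℕ} (Ω : Set (EuclideanSpace ℝ (Fin n))) (ξ : EuclideanSpace ℝ (Fin n) → ℝ)
    (G : Fin n → EuclideanSpace ℝ (Fin n) → ℝ)
    (Hs : Fin n → Fin n → EuclideanSpace ℝ (Fin n) → ℝ) : Prop :=
  L2on Ω ξ ∧ (∀ d, L2on Ω (G d) ∧ IsWeakD Ω ξ (G d) (EuclideanSpace.single d 1)) ∧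
  ∀ d d', L2on Ω (Hs d d') ∧ IsWeakD Ω (G d) (Hs d d') (EuclideanSpace.single d' 1)

/-- Gagliardo-type `H^{1/2}` seminorm finiteness for functions on a domain in `ℝⁿ` -/
def GagH12 {n : ℕ} (Ω : Set (EuclideanSpace ℝ (Fin n))) (u : EuclideanSpace ℝ (Fin n) → ℝ) : Prop :=
  Integrable (fun q : EuclideanSpace ℝ (Fin n) × EuclideanSpace ℝ (Fin n) =>
    (u q.1 - u q.2) ^ 2 / ‖q.1 - q.2‖ ^ (n + 1)) ((volume.restrict Ω).prod (volume.restrict Ω))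

/-- membership in `H^{5/2}` of a domain: weak `H²` data whose second derivatives have finite
`H^{1/2}` Gagliardo seminorm. -/
def MemH52 {n : ℕ} (Ω : Set (EuclideanSpace ℝ (Fin n))) (ζ : EuclideanSpace ℝ (Fin n) → ℝ) : Prop :=
  ∃ G Hs, MemH2W Ω ζ G Hs ∧ ∀ d d', GagH12 Ω (Hs d d')

/-- pointwise trace relation `Tr ζ = (f,g)` on `∂T` for a `C¹` function -/
def TraceEq (p : Fin 3 → E2) (ζ : E2 → ℝ) (f g : Fin 3 → ℝ → ℝ) : Prop :=
  ∀ i : Fin 3, ∀ t ∈ Icc (0:ℝ) 1,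
    ζ (epar p i t) = f i t ∧ fderiv ℝ ζ (epar p i t) (norv p i) = g i t

/-- the vector field 𝔤 (2.11) on edge `i`, at parameter `t` -/
def gfield (p : Fin 3 → E2) (f g : Fin 3 → ℝ → ℝ) (i : Fin 3) (t : ℝ) : E2 :=
  ((elen p i)⁻¹ * derivWithin (f i) (Icc 0 1) t) • tangv p i + g i t • norv p i

/-- the Laplacian of a (smooth) function on `E2` -/
def lap (φ : E2 → ℝ) (x : E2) : ℝ :=
  ∑ i : Fin 2, fderiv ℝ (fun y => fderiv ℝ φ y (stdb2 i)) x (stdb2 i)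

/-- `bu` is the edgewise boundary trace of `u` on `∂T` (in the parametrization `epar`),
expressed through the divergence theorem; `Du` is the weak gradient of `u` on `T`. -/
def HasFaceTrace (p : Fin 3 → E2) (u : E2 → ℝ) (Du : Fin 2 → E2 → ℝ)
    (bu : Fin 3 → ℝ → ℝ) : Prop :=
  ∀ φ : E2 → ℝ, ContDiff ℝ (⊤ : ℕ∞) φ → HasCompactSupport φ → ∀ d : Fin 2,
    ∫ x in tri p, (u x * fderiv ℝ φ x (stdb2 d) + Du d x * φ x)
      = ∑ j : Fin 3, elen p j * ∫ t in Ioo (0:ℝ) 1, bu j t * φ (epar p j t) * norv p j d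

/-- `Tr ξ = (f,g)` in the weak (integration by parts) sense: the boundary trace of `ξ`
is `f` and the boundary trace of its gradient is `(∂f/∂t) t + g n` (cf. (2.5), (2.11)). -/
def TraceW (p : Fin 3 → E2) (ξ : E2 → ℝ) (G : Fin 2 → E2 → ℝ)
    (Hs : Fin 2 → Fin 2 → E2 → ℝ) (f g : Fin 3 → ℝ → ℝ) : Prop :=
  HasFaceTrace p ξ G f ∧
  ∀ d : Fin 2, HasFaceTrace p (G d) (fun d' => Hs d d') (fun j t => gfield p f g j t d)
/-- `u : ℝ → ℝ` is a polynomial of degree at most `m` (`{0}` if `m < 0`) -/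
def IsPolyDegLe (m : ℤ) (u : ℝ → ℝ) : Prop :=
  ∃ Q : Polynomial ℝ, (∀ n : ℕ, m < (n : ℤ) → Q.coeff n = 0) ∧ ∀ t, u t = Q.eval t

/-- `u : E2 → ℝ` is a polynomial of total degree at most `m` (`{0}` if `m < 0`) -/
def IsPoly2DegLe (m : ℤ) (u : E2 → ℝ) : Prop :=
  ∃ Q : MvPolynomial (Fin 2) ℝ,
    (∀ d : Fin 2 →₀ ℕ, m < ((d 0 + d 1 : ℕ) : ℤ) → MvPolynomial.coeff d Q = 0) ∧
    ∀ x : E2, u x = MvPolynomial.eval (fun i => x i) Q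

/-- the reference triangle with vertices (0,0), (1,0), (0,1) -/
def refTri : Fin 3 → E2 :=
  ![0, EuclideanSpace.single 0 1, EuclideanSpace.single 1 1]

/-- the distributional bilaplacian of `ξ` on `T` is a polynomial of degree ≤ m -/
def BiharmPoly (p : Fin 3 → E2) (m : ℤ) (ξ : E2 → ℝ) : Prop :=
  ∃ ρ : E2 → ℝ, IsPoly2DegLe m ρ ∧
    ∀ φ : E2 → ℝ, ContDiff ℝ (⊤ : ℕ∞) φ → HasCompactSupport φ → tsupport φ ⊆ tri p →
      ∫ x in tri p, ξ x * lap (lap φ) x = ∫ x in tri p, ρ x * φ x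

/-- `ξ` belongs to the virtual element space `𝒱^k(T)` (defined here for the
reference triangle `p = refTri`), with trace pair `(f,g) ∈ (H²×H¹)_{k,k-1}(∂T)`. -/
def MemVEMT (p : Fin 3 → E2) (k : ℕ) (ξ : E2 → ℝ) (f g : Fin 3 → ℝ → ℝ) : Prop :=
  (∀ i, IsPolyDegLe (k : ℤ) (f i) ∧ IsPolyDegLe ((k : ℤ) - 1) (g i)) ∧
  Compat p f g ∧
  ∃ G Hs, MemH2W (tri p) ξ G Hs ∧ TraceW p ξ G Hs f g ∧ BiharmPoly p ((k : ℤ) - 4) ξ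
/-- the affine map sending the reference triangle onto the triangle with vertices `p`
(orientation preserving when `ccw p`) -/
def affMap (p : Fin 3 → E2) (x : E2) : E2 := p 0 + x 0 • (p 1 - p 0) + x 1 • (p 2 - p 0)

/-- `ξ ∈ 𝒱^k(T)` for a general triangle `T`, defined through the pullback to the
reference triangle, with trace pair `(f,g) ∈ (H²×H¹)_{k,k-1}(∂T)` exposed. -/
def MemVEMgenT (p : Fin 3 → E2) (k : ℕ) (ξ : E2 → ℝ) (f g : Fin 3 → ℝ → ℝ) : Prop :=
  (∃ fr gr, MemVEMT refTri k (fun x => ξ (affMap p x)) fr gr) ∧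
  (∀ i, IsPolyDegLe (k : ℤ) (f i) ∧ IsPolyDegLe ((k : ℤ) - 1) (g i)) ∧
  Compat p f g ∧
  ∃ G Hs, MemH2W (tri p) ξ G Hs ∧ TraceW p ξ G Hs f g

/-! ### Test functions and Laplacians -/

lemma vu_dd_smooth {φ : E2 → ℝ} (h : ContDiff ℝ (⊤ : ℕ∞) φ) (v : E2) :
    ContDiff ℝ (⊤ : ℕ∞) (fun y => fderiv ℝ φ y v) := by
  have h1 : ContDiff ℝ (⊤ : ℕ∞) (fderiv ℝ φ) := h.fderiv_right (by simp)
  exact h1.clm_apply contDiff_const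

lemma vu_lap_smooth {φ : E2 → ℝ} (h : ContDiff ℝ (⊤ : ℕ∞) φ) :
    ContDiff ℝ (⊤ : ℕ∞) (lap φ) := by
  unfold lap
  exact ContDiff.sum fun i _ => vu_dd_smooth (vu_dd_smooth h _) _

lemma vu_lap_tsupport (φ : E2 → ℝ) : tsupport (lap φ) ⊆ tsupport φ := by
  refine closure_minimal ?_ (isClosed_tsupport _)
  intro x hx
  by_contra hn
  apply hx
  unfold lap
  refine Finset.sum_eq_zero fun i _ => ?_
  have h1 := (tsupport_fderiv_apply_subset ℝ (f := fun y => fderiv ℝ φ y (stdb2 i)) (stdb2 i)).trans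
    (tsupport_fderiv_apply_subset ℝ (f := φ) (stdb2 i))
  exact image_eq_zero_of_notMem_tsupport
    (f := fun x => fderiv ℝ (fun y => fderiv ℝ φ y (stdb2 i)) x (stdb2 i)) fun h => hn (h1 h)

lemma vu_lap_compact {φ : E2 → ℝ} (h : HasCompactSupport φ) : HasCompactSupport (lap φ) :=
  h.mono' ((subset_tsupport _).trans (vu_lap_tsupport φ))

lemma vu_fderiv_affine {ψ : E2 → ℝ} (hψ : ContDiff ℝ (⊤ : ℕ∞) ψ) {A : E2 → E2} {L : E2 →L[ℝ] E2}
    (hA : ∀ x, HasFDerivAt A L x) (x v : E2) :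
    fderiv ℝ (fun y => ψ (A y)) x v = fderiv ℝ ψ (A x) (L v) := by
  have h1 : HasFDerivAt ψ (fderiv ℝ ψ (A x)) (A x) :=
    ((hψ.differentiable (by simp)) (A x)).hasFDerivAt
  have h2 : HasFDerivAt (fun y => ψ (A y)) ((fderiv ℝ ψ (A x)).comp L) x := h1.comp x (hA x)
  rw [h2.fderiv]; rfl

lemma vu_lap_affine {ψ : E2 → ℝ} (hψ : ContDiff ℝ (⊤ : ℕ∞) ψ) {A : E2 → E2} {L : E2 →L[ℝ] E2}
    (hA : ∀ x, HasFDerivAt A L x) (x : E2) :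
    lap (fun y => ψ (A y)) x =
      ∑ i : Fin 2, fderiv ℝ (fun y => fderiv ℝ ψ y (L (stdb2 i))) (A x) (L (stdb2 i)) := by
  unfold lap
  refine Finset.sum_congr rfl fun i _ => ?_
  have : (fun y => fderiv ℝ (fun y => ψ (A y)) y (stdb2 i)) =
      fun y => (fun z => fderiv ℝ ψ z (L (stdb2 i))) (A y) := by
    funext y; exact vu_fderiv_affine hψ hA y _
  rw [this, vu_fderiv_affine (vu_dd_smooth hψ _) hA]

lemma vu_lap_homothety {ψ : E2 → ℝ} (hψ : ContDiff ℝ (⊤ : ℕ∞) ψ) (a : E2) (l : ℝ) (x : E2) :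
    lap (fun y => ψ (a - l • y)) x = l ^ 2 * lap ψ (a - l • x) := by
  have hA : ∀ x : E2, HasFDerivAt (fun y : E2 => a - l • y) (-(l • ContinuousLinearMap.id ℝ E2)) x := by
    intro x
    exact ((hasFDerivAt_id x).const_smul l).const_sub a
  rw [vu_lap_affine hψ hA]
  unfold lap
  rw [Finset.mul_sum]
  refine Finset.sum_congr rfl fun i _ => ?_
  have : (fun y => fderiv ℝ ψ y ((-(l • ContinuousLinearMap.id ℝ E2)) (stdb2 i))) =
      fun y => (-l) • fderiv ℝ ψ y (stdb2 i) := by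
    funext y; simp
  rw [this, fderiv_fun_const_smul ((vu_dd_smooth hψ _).differentiable (by simp) _)]
  simp; ring

/-! ### Integrals depending on a parameter -/

lemma vu_F_hasFDerivAt {μ : Measure E2} {u : E2 → ℝ} (hu : Integrable u μ) {m : E2 → E2}
    (hm : Continuous m) {K : E2 → ℝ} (hK : ContDiff ℝ (⊤ : ℕ∞) K) (hKc : HasCompactSupport K)
    (x : E2) :
    HasFDerivAt (fun x => ∫ z, u z * K (x - m z) ∂μ) (∫ z, u z • fderiv ℝ K (x - m z) ∂μ) x := by
  have hKd : Continuous (fderiv ℝ K) := hK.continuous_fderiv (by simp)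
  obtain ⟨C, hC⟩ := hKd.bounded_above_of_compact_support (hKc.fderiv ℝ)
  obtain ⟨C', hC'⟩ := hK.continuous.bounded_above_of_compact_support hKc
  refine hasFDerivAt_integral_of_dominated_of_fderiv_le (s := univ)
    (F := fun x z => u z * K (x - m z)) (F' := fun x z => u z • fderiv ℝ K (x - m z))
    (bound := fun z => ‖u z‖ * C) Filter.univ_mem ?_ ?_ ?_ ?_ ?_ ?_
  · refine Filter.Eventually.of_forall fun y => ?_
    exact hu.aestronglyMeasurable.mul
      (hK.continuous.comp (continuous_const.sub hm)).aestronglyMeasurable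
  · exact hu.mul_bdd (c := C')
      (hK.continuous.comp (continuous_const.sub hm)).aestronglyMeasurable
      (Filter.Eventually.of_forall fun z => hC' _)
  · exact hu.aestronglyMeasurable.smul
      (hKd.comp (continuous_const.sub hm)).aestronglyMeasurable
  · refine Filter.Eventually.of_forall fun z y _ => ?_
    rw [norm_smul]
    exact mul_le_mul_of_nonneg_left (hC _) (norm_nonneg _)
  · exact hu.norm.mul_const C
  · refine Filter.Eventually.of_forall fun z y _ => ?_
    have h1 : HasFDerivAt K (fderiv ℝ K (y - m z)) (y - m z) :=
      ((hK.differentiable (by simp)) _).hasFDerivAt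
    have h2 : HasFDerivAt (fun y => K (y - m z)) (fderiv ℝ K (y - m z)) y := by
      have := h1.comp y ((hasFDerivAt_id y).sub_const (m z))
      simpa [Function.comp_def] using! this
    exact h2.const_mul (u z)

lemma vu_F_fderiv {μ : Measure E2} {u : E2 → ℝ} (hu : Integrable u μ) {m : E2 → E2}
    (hm : Continuous m) {K : E2 → ℝ} (hK : ContDiff ℝ (⊤ : ℕ∞) K) (hKc : HasCompactSupport K)
    (x v : E2) :
    fderiv ℝ (fun x => ∫ z, u z * K (x - m z) ∂μ) x v =
      ∫ z, u z * (fun y => fderiv ℝ K y v) (x - m z) ∂μ := by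
  rw [(vu_F_hasFDerivAt hu hm hK hKc x).fderiv]
  have hKd : Continuous (fderiv ℝ K) := hK.continuous_fderiv (by simp)
  obtain ⟨C, hC⟩ := hKd.bounded_above_of_compact_support (hKc.fderiv ℝ)
  rw [ContinuousLinearMap.integral_apply]
  · rfl
  · exact hu.smul_bdd C (hKd.comp (continuous_const.sub hm)).aestronglyMeasurable
      (Filter.Eventually.of_forall fun z => hC _)

lemma vu_F_contDiff {μ : Measure E2} {u : E2 → ℝ} (hu : Integrable u μ) {m : E2 → E2}
    (hm : Continuous m) (n : ℕ) : ∀ {K : E2 → ℝ} (_ : ContDiff ℝ (⊤ : ℕ∞) K)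
    (_ : HasCompactSupport K), ContDiff ℝ n (fun x => ∫ z, u z * K (x - m z) ∂μ) := by
  induction n with
  | zero =>
    intro K hK hKc
    refine contDiff_zero.2 ?_
    exact continuous_iff_continuousAt.2 fun x => (vu_F_hasFDerivAt hu hm hK hKc x).continuousAt
  | succ n ih =>
    intro K hK hKc
    push_cast
    rw [contDiff_succ_iff_fderiv_apply]
    refine ⟨fun x => (vu_F_hasFDerivAt hu hm hK hKc x).differentiableAt, by simp, fun v => ?_⟩
    have := ih (vu_dd_smooth hK v) (hKc.fderiv_apply ℝ v)
    convert this using 2 with x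
    exact vu_F_fderiv hu hm hK hKc x v

lemma vu_F_smooth {μ : Measure E2} {u : E2 → ℝ} (hu : Integrable u μ) {m : E2 → E2}
    (hm : Continuous m) {K : E2 → ℝ} (hK : ContDiff ℝ (⊤ : ℕ∞) K)
    (hKc : HasCompactSupport K) : ContDiff ℝ (⊤ : ℕ∞) (fun x => ∫ z, u z * K (x - m z) ∂μ) :=
  contDiff_infty.2 fun n => vu_F_contDiff hu hm n hK hKc

lemma vu_F_lap {μ : Measure E2} {u : E2 → ℝ} (hu : Integrable u μ) {m : E2 → E2}
    (hm : Continuous m) {K : E2 → ℝ} (hK : ContDiff ℝ (⊤ : ℕ∞) K)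
    (hKc : HasCompactSupport K) (x : E2) :
    lap (fun x => ∫ z, u z * K (x - m z) ∂μ) x = ∫ z, u z * lap K (x - m z) ∂μ := by
  have hintg : ∀ {k : E2 → ℝ}, ContDiff ℝ (⊤ : ℕ∞) k → HasCompactSupport k →
      Integrable (fun z => u z * k (x - m z)) μ := by
    intro k hk hkc
    obtain ⟨C', hC'⟩ := hk.continuous.bounded_above_of_compact_support hkc
    exact hu.mul_bdd (c := C')
      (hk.continuous.comp (continuous_const.sub hm)).aestronglyMeasurable
      (Filter.Eventually.of_forall fun z => hC' _)
  have : ∀ z, u z * lap K (x - m z) = ∑ i : Fin 2,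
      u z * (fun w => fderiv ℝ (fun y => fderiv ℝ K y (stdb2 i)) w (stdb2 i)) (x - m z) := by
    intro z; unfold lap; rw [Finset.mul_sum]
  simp_rw [this]
  rw [integral_finsetSum _ fun i _ => hintg (vu_dd_smooth (vu_dd_smooth hK _) _)
    ((hKc.fderiv_apply ℝ _).fderiv_apply ℝ _)]
  unfold lap
  refine Finset.sum_congr rfl fun i _ => ?_
  have h1 : (fun y => fderiv ℝ (fun x => ∫ z, u z * K (x - m z) ∂μ) y (stdb2 i)) =
      fun y => ∫ z, u z * (fun y => fderiv ℝ K y (stdb2 i)) (y - m z) ∂μ := by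
    funext y; exact vu_F_fderiv hu hm hK hKc y _
  rw [h1, vu_F_fderiv hu hm (vu_dd_smooth hK _) (hKc.fderiv_apply ℝ _)]

/-! ### The smoothing kernel -/

/-- the smoothing kernel, with the dilation `z ↦ a + l • z` built in -/
def vuK (b : ContDiffBump (0 : E2)) (a : E2) (l : ℝ) (x z : E2) : ℝ :=
  b.normed volume (x - (a + l • z))

lemma vuK_nonneg (b : ContDiffBump (0 : E2)) (a : E2) (l : ℝ) (x z : E2) : 0 ≤ vuK b a l x z :=
  b.nonneg_normed _

lemma vu_normed_smooth (b : ContDiffBump (0 : E2)) :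
    ContDiff ℝ (⊤ : ℕ∞) (b.normed volume) := b.contDiff_normed

lemma vuK_cont (b : ContDiffBump (0 : E2)) (a : E2) (l : ℝ) :
    Continuous (fun q : E2 × E2 => vuK b a l q.1 q.2) := by
  unfold vuK
  exact (vu_normed_smooth b).continuous.comp (by fun_prop)

lemma vuK_bdd (b : ContDiffBump (0 : E2)) (a : E2) (l : ℝ) :
    ∃ C, ∀ x z, ‖vuK b a l x z‖ ≤ C := by
  obtain ⟨C, hC⟩ := (vu_normed_smooth b).continuous.bounded_above_of_compact_support
    b.hasCompactSupport_normed
  exact ⟨C, fun x z => hC _⟩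

lemma vuK_int_x (b : ContDiffBump (0 : E2)) (a : E2) (l : ℝ) (z : E2) :
    Integrable (fun x => vuK b a l x z) ∧ ∫ x, vuK b a l x z = 1 := by
  unfold vuK
  constructor
  · exact b.integrable_normed.comp_sub_right (a + l • z)
  · rw [integral_sub_right_eq_self (fun x => b.normed volume x)]
    exact b.integral_normed

lemma vuK_int_z (b : ContDiffBump (0 : E2)) (a : E2) {l : ℝ} (hl : 1 / 2 ≤ l) (x : E2) :
    Integrable (fun z => vuK b a l x z) ∧ ∫ z, vuK b a l x z ≤ 4 := by
  unfold vuK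
  have h0 : l ≠ 0 := by linarith
  have he : (fun z : E2 => b.normed volume (x - (a + l • z))) =
      fun z => (fun w => b.normed volume ((x - a) - w)) (l • z) := by
    funext z; simp only [sub_sub]
  have hi : Integrable (fun w => b.normed volume ((x - a) - w)) :=
    b.integrable_normed.comp_sub_left (x - a)
  rw [he]
  constructor
  · exact (integrable_comp_smul_iff volume _ h0).2 hi
  · rw [Measure.integral_comp_smul volume (fun w => b.normed volume ((x - a) - w)) l,
      integral_sub_left_eq_self (fun w => b.normed volume w), b.integral_normed]
    simp only [finrank_euclideanSpace, Fintype.card_fin, smul_eq_mul, mul_one]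
    rw [abs_of_nonneg (by positivity)]
    have : (1/4 : ℝ) ≤ l ^ 2 := by nlinarith
    calc (l ^ 2)⁻¹ ≤ (1 / 4 : ℝ)⁻¹ := inv_anti₀ (by norm_num) this
      _ = 4 := by norm_num

section
variable {Ω : Set E2}

lemma vu_prod_int [IsFiniteMeasure (volume.restrict Ω)] {f g : E2 → ℝ}
    (hf : Integrable f (volume.restrict Ω))
    (hg : Integrable g (volume.restrict Ω)) (b : ContDiffBump (0 : E2)) (a : E2) (l : ℝ) :
    Integrable (fun q : E2 × E2 => f q.1 * g q.2 * vuK b a l q.1 q.2)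
      ((volume.restrict Ω).prod (volume.restrict Ω)) := by
  obtain ⟨C, hC⟩ := vuK_bdd b a l
  exact (hf.mul_prod hg).mul_bdd (c := C) (vuK_cont b a l).aestronglyMeasurable
    (Filter.Eventually.of_forall fun q => hC _ _)

lemma vu_B_prod [IsFiniteMeasure (volume.restrict Ω)] {f g : E2 → ℝ}
    (hf : Integrable f (volume.restrict Ω))
    (hg : Integrable g (volume.restrict Ω)) (b : ContDiffBump (0 : E2)) (a : E2) (l : ℝ) :
    ∫ x in Ω, f x * ∫ z in Ω, g z * vuK b a l x z =
      ∫ q, f q.1 * g q.2 * vuK b a l q.1 q.2 ∂((volume.restrict Ω).prod (volume.restrict Ω)) := by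
  rw [integral_prod _ (vu_prod_int hf hg b a l)]
  refine integral_congr_ae (Filter.Eventually.of_forall fun x => ?_)
  simp only [mul_assoc, integral_const_mul]

lemma vu_B_swap [IsFiniteMeasure (volume.restrict Ω)] {f g : E2 → ℝ}
    (hf : Integrable f (volume.restrict Ω))
    (hg : Integrable g (volume.restrict Ω)) (b : ContDiffBump (0 : E2)) (a : E2) (l : ℝ) :
    ∫ x in Ω, f x * ∫ z in Ω, g z * vuK b a l x z =
      ∫ z in Ω, g z * ∫ x in Ω, f x * vuK b a l x z := by
  rw [vu_B_prod hf hg, integral_prod_symm _ (vu_prod_int hf hg b a l)]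
  refine integral_congr_ae (Filter.Eventually.of_forall fun x => ?_)
  simp only
  rw [← integral_const_mul]
  congr 1; funext z; ring

lemma vu_amgm (x y : ℝ) {s : ℝ} (hs : 0 < s) : |x * y| ≤ s⁻¹ * x ^ 2 + s * y ^ 2 := by
  have h : s * (s⁻¹ * x ^ 2 + s * y ^ 2) = x ^ 2 + (s * y) ^ 2 := by field_simp
  have h2 : s * |x * y| ≤ x ^ 2 + (s * y) ^ 2 := by
    have : s * |x * y| = |x * (s * y)| := by
      rw [abs_mul, abs_mul, abs_mul, abs_of_pos hs]; ring
    rw [this, abs_le]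
    constructor <;> nlinarith [sq_nonneg (x + s * y), sq_nonneg (x - s * y), sq_nonneg x, sq_nonneg (s*y)]
  rw [← h] at h2
  exact le_of_mul_le_mul_left h2 hs

lemma vu_schur [IsFiniteMeasure (volume.restrict Ω)] {f g : E2 → ℝ}
    (hf : MemLp f 2 (volume.restrict Ω))
    (hg : MemLp g 2 (volume.restrict Ω)) (b : ContDiffBump (0 : E2)) (a : E2) {l : ℝ}
    (hl : 1 / 2 ≤ l) {s : ℝ} (hs : 0 < s) :
    |∫ x in Ω, f x * ∫ z in Ω, g z * vuK b a l x z| ≤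
      4 * s⁻¹ * (∫ x in Ω, f x ^ 2) + s * ∫ x in Ω, g x ^ 2 := by
  have hf1 := hf.integrable (by norm_num)
  have hg1 := hg.integrable (by norm_num)
  have hf2 := hf.integrable_sq
  have hg2 := hg.integrable_sq
  have h1 : Integrable (fun _ : E2 => (1 : ℝ)) (volume.restrict Ω) := integrable_const _
  have i1 := vu_prod_int hf2 h1 b a l
  have i2 := vu_prod_int h1 hg2 b a l
  rw [vu_B_prod hf1 hg1]
  refine (abs_integral_le_integral_abs).trans ?_
  have step : ∫ q, |f q.1 * g q.2 * vuK b a l q.1 q.2|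
        ∂((volume.restrict Ω).prod (volume.restrict Ω)) ≤
      ∫ q, (s⁻¹ * (f q.1 ^ 2 * 1 * vuK b a l q.1 q.2) + s * (1 * g q.2 ^ 2 * vuK b a l q.1 q.2))
        ∂((volume.restrict Ω).prod (volume.restrict Ω)) := by
    refine integral_mono (vu_prod_int hf1 hg1 b a l).abs
      ((i1.const_mul _).add (i2.const_mul _)) fun q => ?_
    simp only
    rw [abs_mul, abs_of_nonneg (vuK_nonneg b a l _ _)]
    have := mul_le_mul_of_nonneg_right (vu_amgm (f q.1) (g q.2) hs) (vuK_nonneg b a l q.1 q.2)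
    linarith
  refine step.trans ?_
  rw [integral_add (i1.const_mul _) (i2.const_mul _), integral_const_mul, integral_const_mul,
    ← vu_B_prod hf2 h1, ← vu_B_prod h1 hg2, vu_B_swap h1 hg2]
  have e1 : ∫ x in Ω, f x ^ 2 * ∫ z in Ω, 1 * vuK b a l x z ≤ 4 * ∫ x in Ω, f x ^ 2 := by
    rw [← integral_const_mul]
    refine integral_mono_of_nonneg (Filter.Eventually.of_forall fun x => ?_) (hf2.const_mul 4)
      (Filter.Eventually.of_forall fun x => ?_)
    · exact mul_nonneg (sq_nonneg _) (integral_nonneg fun z => by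
        simpa using vuK_nonneg b a l x z)
    · have := vuK_int_z b a hl x
      have h3 : ∫ z in Ω, 1 * vuK b a l x z ≤ 4 := by
        simp only [one_mul]
        exact (setIntegral_le_integral this.1
          (Filter.Eventually.of_forall fun z => vuK_nonneg b a l x z)).trans this.2
      have := mul_le_mul_of_nonneg_left h3 (sq_nonneg (f x))
      simp only; linarith
  have e2 : ∫ z in Ω, g z ^ 2 * ∫ x in Ω, 1 * vuK b a l x z ≤ ∫ x in Ω, g x ^ 2 := by
    refine integral_mono_of_nonneg (Filter.Eventually.of_forall fun x => ?_) hg2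
      (Filter.Eventually.of_forall fun z => ?_)
    · exact mul_nonneg (sq_nonneg _) (integral_nonneg fun z => by
        simpa using vuK_nonneg b a l z x)
    · have := vuK_int_x b a l z
      have h3 : ∫ x in Ω, 1 * vuK b a l x z ≤ 1 := by
        simp only [one_mul]
        exact (setIntegral_le_integral this.1
          (Filter.Eventually.of_forall fun x => vuK_nonneg b a l x z)).trans this.2.le
      have := mul_le_mul_of_nonneg_left h3 (sq_nonneg (g z))
      simp only; linarith
  have := mul_le_mul_of_nonneg_left e1 (inv_nonneg.2 hs.le)
  have := mul_le_mul_of_nonneg_left e2 hs.le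
  linarith

lemma vu_lim_cont [IsFiniteMeasure (volume.restrict Ω)] (hΩ : IsOpen Ω) {f g : E2 → ℝ}
    (hf : Continuous f) (hfc : HasCompactSupport f)
    (hg : MemLp g 2 (volume.restrict Ω)) (b : ℕ → ContDiffBump (0 : E2)) (a : ℕ → E2) (l : ℕ → ℝ)
    (hb : Filter.Tendsto (fun n => (b n).rOut) Filter.atTop (nhds 0))
    (ha : Filter.Tendsto a Filter.atTop (nhds 0))
    (hl : Filter.Tendsto l Filter.atTop (nhds 1)) :
    Filter.Tendsto (fun n => ∫ x in Ω, f x * ∫ z in Ω, g z * vuK (b n) (a n) (l n) x z)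
      Filter.atTop (nhds (∫ x in Ω, f x * g x)) := by
  have hf1 : Integrable f (volume.restrict Ω) :=
    (hf.integrable_of_hasCompactSupport hfc).restrict
  have hg1 := hg.integrable (by norm_num)
  obtain ⟨C, hC⟩ := hf.bounded_above_of_compact_support hfc
  have hfi := hf.integrable_of_hasCompactSupport hfc (μ := volume)
  simp_rw [fun n => vu_B_swap hf1 hg1 (b n) (a n) (l n)]
  have hKm : ∀ n, AEStronglyMeasurable (fun z => ∫ x in Ω, f x * vuK (b n) (a n) (l n) x z)
      (volume.restrict Ω) := by
    intro n
    have h1 : Integrable (fun _ : E2 => (1 : ℝ)) (volume.restrict Ω) := integrable_const _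
    have := (vu_prod_int hf1 h1 (b n) (a n) (l n)).integral_prod_right.aestronglyMeasurable
    simpa using this
  refine tendsto_integral_of_dominated_convergence (fun z => ‖g z‖ * C) ?_ (hg1.norm.mul_const C) ?_ ?_
  · intro n
    exact hg1.aestronglyMeasurable.mul (hKm n)
  · intro n
    refine Filter.Eventually.of_forall fun z => ?_
    rw [norm_mul]
    refine mul_le_mul_of_nonneg_left ?_ (norm_nonneg _)
    have hk := vuK_int_x (b n) (a n) (l n) z
    calc ‖∫ x in Ω, f x * vuK (b n) (a n) (l n) x z‖
        ≤ ∫ x in Ω, C * vuK (b n) (a n) (l n) x z := by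
          refine norm_integral_le_of_norm_le (hk.1.restrict.const_mul C)
            (Filter.Eventually.of_forall fun x => ?_)
          rw [norm_mul, Real.norm_of_nonneg (vuK_nonneg _ _ _ _ _)]
          exact mul_le_mul_of_nonneg_right (hC x) (vuK_nonneg _ _ _ _ _)
      _ ≤ C * 1 := by
          rw [integral_const_mul]
          refine mul_le_mul_of_nonneg_left ?_ ((norm_nonneg _).trans (hC 0))
          rw [← hk.2]
          exact setIntegral_le_integral hk.1
            (Filter.Eventually.of_forall fun x => vuK_nonneg _ _ _ _ _)
      _ = C := mul_one C
  · filter_upwards [ae_restrict_mem hΩ.measurableSet] with z hz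
    rw [mul_comm (f z)]
    refine Filter.Tendsto.const_mul _ ?_
    have key := ContDiffBump.convolution_tendsto_right (μ := (volume : Measure E2)) (φ := b)
      (g := fun _ => indicator Ω f) (k := fun n => a n + l n • z) (x₀ := z) (z₀ := f z) hb
      (Filter.Eventually.of_forall fun n =>
        (hfi.indicator hΩ.measurableSet).aestronglyMeasurable) ?_ ?_
    · refine key.congr fun n => ?_
      rw [convolution_eq_swap, ← integral_indicator hΩ.measurableSet]
      refine integral_congr_ae (Filter.Eventually.of_forall fun x => ?_)
      have hsym : (b n).normed volume (a n + l n • z - x) = vuK (b n) (a n) (l n) x z := by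
        unfold vuK
        rw [← (b n).normed_neg, neg_sub]
      by_cases hx : x ∈ Ω
      · simp [hx, hsym, mul_comm]
      · simp [hx]
    · have : Filter.Tendsto (indicator Ω f) (nhds z) (nhds (f z)) := by
        refine (hf.tendsto z).congr' ?_
        filter_upwards [hΩ.mem_nhds hz] with x hx
        simp [hx]
      exact this.comp Filter.tendsto_snd
    · have := ha.add (hl.smul_const z)
      simpa using this

lemma vu_lim [IsFiniteMeasure (volume.restrict Ω)] (hΩ : IsOpen Ω) {f g : E2 → ℝ}
    (hf : MemLp f 2 (volume.restrict Ω))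
    (hg : MemLp g 2 (volume.restrict Ω)) (b : ℕ → ContDiffBump (0 : E2)) (a : ℕ → E2) (l : ℕ → ℝ)
    (hb : Filter.Tendsto (fun n => (b n).rOut) Filter.atTop (nhds 0))
    (ha : Filter.Tendsto a Filter.atTop (nhds 0))
    (hl : Filter.Tendsto l Filter.atTop (nhds 1)) (hl2 : ∀ n, 1 / 2 ≤ l n) :
    Filter.Tendsto (fun n => ∫ x in Ω, f x * ∫ z in Ω, g z * vuK (b n) (a n) (l n) x z)
      Filter.atTop (nhds (∫ x in Ω, f x * g x)) := by
  rw [Metric.tendsto_atTop]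
  intro ε hε
  set N := ∫ x in Ω, g x ^ 2 with hN
  have hN0 : 0 ≤ N := integral_nonneg fun x => sq_nonneg _
  set s : ℝ := ε / (8 * (N + 1)) with hs
  have hs0 : 0 < s := by positivity
  have hsN : s * N ≤ ε / 8 := by
    rw [hs, div_mul_eq_mul_div, div_le_div_iff₀ (by positivity) (by norm_num)]
    nlinarith
  have hf' : MemLp f (ENNReal.ofReal 2) (volume.restrict Ω) := by simpa using hf
  obtain ⟨ψ, hψc, hψle, hψcont, hψ2⟩ := hf'.exists_hasCompactSupport_integral_rpow_sub_le
    (p := 2) (by norm_num) (ε := s * (ε / 32)) (by positivity)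
  have hψ2' : MemLp ψ 2 (volume.restrict Ω) := by simpa using hψ2
  have hd : MemLp (f - ψ) 2 (volume.restrict Ω) := hf.sub hψ2'
  have hdle : ∫ x in Ω, (f - ψ) x ^ 2 ≤ s * (ε / 32) := by
    refine le_trans (le_of_eq ?_) hψle
    refine integral_congr_ae (Filter.Eventually.of_forall fun x => ?_)
    simp [sq_abs]
  have hbound : 4 * s⁻¹ * (∫ x in Ω, (f - ψ) x ^ 2) + s * N ≤ ε / 4 := by
    have : 4 * s⁻¹ * (∫ x in Ω, (f - ψ) x ^ 2) ≤ 4 * s⁻¹ * (s * (ε / 32)) :=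
      mul_le_mul_of_nonneg_left hdle (by positivity)
    have e : 4 * s⁻¹ * (s * (ε / 32)) = ε / 8 := by field_simp; ring
    linarith
  obtain ⟨n0, hn0⟩ := Metric.tendsto_atTop.1 (vu_lim_cont hΩ hψcont hψc hg b a l hb ha hl)
    (ε / 4) (by positivity)
  refine ⟨n0, fun n hn => ?_⟩
  have h1 := hn0 n hn
  have hf1 := hf.integrable (by norm_num)
  have hψ1 := hψ2'.integrable (by norm_num)
  have hg1 := hg.integrable (by norm_num)
  have h2 := vu_schur hd hg (b n) (a n) (hl2 n) hs0
  have h2' : ∫ x in Ω, (f - ψ) x * ∫ z in Ω, g z * vuK (b n) (a n) (l n) x z =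
      (∫ x in Ω, f x * ∫ z in Ω, g z * vuK (b n) (a n) (l n) x z) -
      ∫ x in Ω, ψ x * ∫ z in Ω, g z * vuK (b n) (a n) (l n) x z := by
    rw [vu_B_prod (hf1.sub hψ1) hg1, vu_B_prod hf1 hg1, vu_B_prod hψ1 hg1, ← integral_sub
      (vu_prod_int hf1 hg1 _ _ _) (vu_prod_int hψ1 hg1 _ _ _)]
    congr 1; funext q; simp only [Pi.sub_apply]; ring
  rw [h2'] at h2
  have h3 : |∫ x in Ω, (f - ψ) x * g x| ≤ 4 * s⁻¹ * (∫ x in Ω, (f - ψ) x ^ 2) + s * N := by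
    refine abs_integral_le_integral_abs.trans ?_
    have : ∫ x in Ω, |(f - ψ) x * g x| ≤ ∫ x in Ω, (s⁻¹ * (f - ψ) x ^ 2 + s * g x ^ 2) :=
      integral_mono (hd.integrable_mul hg).abs
        ((hd.integrable_sq.const_mul _).add (hg.integrable_sq.const_mul _))
        fun x => vu_amgm _ _ hs0
    rw [integral_add (hd.integrable_sq.const_mul _) (hg.integrable_sq.const_mul _),
      integral_const_mul, integral_const_mul] at this
    have hp : 0 ≤ s⁻¹ * ∫ x in Ω, (f - ψ) x ^ 2 :=
      mul_nonneg (inv_nonneg.2 hs0.le) (integral_nonneg fun x => sq_nonneg _)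
    linarith
  have h3' : ∫ x in Ω, (f - ψ) x * g x = (∫ x in Ω, f x * g x) - ∫ x in Ω, ψ x * g x := by
    have i1 : Integrable (fun x => f x * g x) (volume.restrict Ω) := hf.integrable_mul hg
    have i2 : Integrable (fun x => ψ x * g x) (volume.restrict Ω) := hψ2'.integrable_mul hg
    rw [← integral_sub i1 i2]
    congr 1; funext q; simp only [Pi.sub_apply]; ring
  rw [h3'] at h3
  rw [Real.dist_eq] at h1 ⊢
  have := h2.trans hbound
  have := h3.trans hbound
  rw [abs_lt] at h1 ⊢
  rw [abs_le] at *
  constructor <;> linarith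

end

/-! ### A compactly supported function with vanishing distributional Laplacian vanishes -/

lemma vu_lap_congr {φ ψ : E2 → ℝ} {x : E2} (h : φ =ᶠ[nhds x] ψ) : lap φ x = lap ψ x := by
  unfold lap
  refine Finset.sum_congr rfl fun i _ => ?_
  have h1 : (fun y => fderiv ℝ φ y (stdb2 i)) =ᶠ[nhds x] fun y => fderiv ℝ ψ y (stdb2 i) := by
    filter_upwards [h.fderiv (𝕜 := ℝ)] with y hy
    rw [hy]
  rw [h1.fderiv_eq]

lemma vu_lap_ridge {F : ℝ → ℝ} (hF : ContDiff ℝ (⊤ : ℕ∞) F) (w x : E2) :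
    lap (fun y => F ⟪y, w⟫) x = deriv (deriv F) ⟪x, w⟫ * ‖w‖ ^ 2 := by
  have hd : ∀ {H : ℝ → ℝ}, ContDiff ℝ (⊤ : ℕ∞) H → ∀ y v : E2,
      fderiv ℝ (fun y : E2 => H ⟪y, w⟫) y v = ⟪v, w⟫ * deriv H ⟪y, w⟫ := by
    intro H hH y v
    have h1 : HasDerivAt H (deriv H ⟪y, w⟫) ⟪y, w⟫ :=
      ((hH.differentiable (by simp)) _).hasDerivAt
    have h2 : HasFDerivAt (fun y : E2 => ⟪y, w⟫) (innerSL ℝ w) y := by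
      have := (innerSL ℝ w).hasFDerivAt (x := y)
      refine this.congr_of_eventuallyEq (Filter.Eventually.of_forall fun z => ?_)
      simp [real_inner_comm]
    have h3 := h1.comp_hasFDerivAt y h2
    have h4 : fderiv ℝ (fun y : E2 => H ⟪y, w⟫) y = deriv H ⟪y, w⟫ • innerSL ℝ w := h3.fderiv
    rw [h4]
    simp [real_inner_comm, mul_comm]
  have hF' : ContDiff ℝ (⊤ : ℕ∞) (deriv F) := by
    rw [contDiff_infty_iff_deriv] at hF
    exact hF.2
  unfold lap
  have : ∀ i : Fin 2, (fun y => fderiv ℝ (fun y : E2 => F ⟪y, w⟫) y (stdb2 i)) =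
      fun y => (fun t => ⟪stdb2 i, w⟫ * deriv F t) ⟪y, w⟫ := by
    intro i; funext y; exact hd hF y _
  simp_rw [this]
  have h5 : ∀ i : Fin 2, fderiv ℝ (fun y => (fun t => ⟪stdb2 i, w⟫ * deriv F t) ⟪y, w⟫) x (stdb2 i)
      = ⟪stdb2 i, w⟫ * (⟪stdb2 i, w⟫ * deriv (deriv F) ⟪x, w⟫) := by
    intro i
    rw [hd (contDiff_const.mul hF'), deriv_const_mul _ ((hF'.differentiable (by simp)) _)]
  simp_rw [h5]
  rw [EuclideanSpace.real_norm_sq_eq]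
  simp [stdb2, EuclideanSpace.inner_single_left, Fin.sum_univ_two]
  ring

lemma vu_zero {Ω : Set E2} (hΩm : MeasurableSet Ω) (hb : Bornology.IsBounded Ω) {u : E2 → ℝ}
    (hu : Integrable u (volume.restrict Ω))
    (H : ∀ φ : E2 → ℝ, ContDiff ℝ (⊤ : ℕ∞) φ → HasCompactSupport φ →
      ∫ x in Ω, u x * lap φ x = 0) : u =ᵐ[volume.restrict Ω] 0 := by
  obtain ⟨R, hR0, hR⟩ := hb.subset_ball_lt 0 0
  let χ : ContDiffBump (0 : E2) := ⟨R, R + 1, hR0, by linarith⟩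
  have Hsm : ∀ φ : E2 → ℝ, ContDiff ℝ (⊤ : ℕ∞) φ → ∫ x in Ω, u x * lap φ x = 0 := by
    intro φ hφ
    have hχ : ContDiff ℝ (⊤ : ℕ∞) (fun x => χ x) := χ.contDiff
    rw [← H (fun x => χ x * φ x) (hχ.mul hφ) (χ.hasCompactSupport.mul_right)]
    refine setIntegral_congr_fun hΩm fun x hx => ?_
    refine congrArg (u x * ·) ?_
    refine vu_lap_congr ?_
    filter_upwards [Metric.isOpen_ball.mem_nhds (hR hx)] with y hy
    rw [χ.one_of_mem_closedBall (Metric.ball_subset_closedBall hy), one_mul]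
  have Hr : ∀ (F : ℝ → ℝ), ContDiff ℝ (⊤ : ℕ∞) F → ∀ w : E2,
      (∫ x in Ω, u x * deriv (deriv F) ⟪x, w⟫) * ‖w‖ ^ 2 = 0 := by
    intro F hF w
    rw [← integral_mul_const, ← Hsm (fun y => F ⟪y, w⟫)
      (hF.comp (contDiff_id.inner ℝ contDiff_const))]
    congr 1; funext x; rw [vu_lap_ridge hF]; ring
  have H0 : ∫ x in Ω, u x = 0 := by
    have := Hr (fun t => t ^ 2) (contDiff_id.pow 2) (EuclideanSpace.single 0 1)
    have e : deriv (deriv (fun t : ℝ => t ^ 2)) = fun _ => 2 := by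
      have : deriv (fun t : ℝ => t ^ 2) = fun t => 2 * t := by funext t; simp
      rw [this]; funext t
      rw [deriv_const_mul _ differentiableAt_id]; simp
    rw [e, integral_mul_const] at this
    simpa using this
  have Hc : ∀ w : E2, ∫ x in Ω, u x * Real.cos ⟪x, w⟫ = 0 := by
    intro w
    by_cases hw : w = 0
    · simpa [hw] using H0
    have := Hr Real.cos Real.contDiff_cos w
    have e : deriv (deriv Real.cos) = fun t => -Real.cos t := by
      rw [Real.deriv_cos']; funext t; simp
    simp only [e, mul_neg, integral_neg] at this
    have hw' : ‖w‖ ≠ 0 := norm_ne_zero_iff.2 hw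
    simpa [hw'] using this
  have Hs : ∀ w : E2, ∫ x in Ω, u x * Real.sin ⟪x, w⟫ = 0 := by
    intro w
    by_cases hw : w = 0
    · simp [hw]
    have := Hr Real.sin Real.contDiff_sin w
    have e : deriv (deriv Real.sin) = fun t => -Real.sin t := by
      rw [Real.deriv_sin]; funext t; simp
    simp only [e, mul_neg, integral_neg] at this
    have hw' : ‖w‖ ≠ 0 := norm_ne_zero_iff.2 hw
    simpa [hw'] using this
  set μ : Measure E2 := volume.restrict Ω with hμ
  have f1 : IsFiniteMeasure (μ.withDensity fun x => ENNReal.ofReal (u x)) :=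
    isFiniteMeasure_withDensity_ofReal hu.2
  have f2 : IsFiniteMeasure (μ.withDensity fun x => ENNReal.ofReal (-u x)) :=
    isFiniteMeasure_withDensity_ofReal hu.neg.2
  have hm1 : AEMeasurable (fun x => ENNReal.ofReal (u x)) μ := hu.aemeasurable.ennreal_ofReal
  have hm2 : AEMeasurable (fun x => ENNReal.ofReal (-u x)) μ := hu.aemeasurable.neg.ennreal_ofReal
  have heq : μ.withDensity (fun x => ENNReal.ofReal (u x)) =
      μ.withDensity (fun x => ENNReal.ofReal (-u x)) := by
    refine Measure.ext_of_charFun (funext fun w => ?_)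
    rw [charFun_apply, charFun_apply,
      integral_withDensity_eq_integral_toReal_smul₀ hm1
        (Filter.Eventually.of_forall fun x => ENNReal.ofReal_lt_top),
      integral_withDensity_eq_integral_toReal_smul₀ hm2
        (Filter.Eventually.of_forall fun x => ENNReal.ofReal_lt_top)]
    have hbd : ∀ {v : E2 → ℝ}, Integrable v μ →
        Integrable (fun x => v x • Complex.exp (⟪x, w⟫ * Complex.I)) μ := by
      intro v hv
      refine hv.smul_bdd 1 (Continuous.aestronglyMeasurable (by fun_prop)) ?_
      exact Filter.Eventually.of_forall fun x => by rw [Complex.norm_exp_ofReal_mul_I]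
    rw [← sub_eq_zero, ← integral_sub]
    · have : ∀ x, (ENNReal.ofReal (u x)).toReal • Complex.exp (⟪x, w⟫ * Complex.I) -
          (ENNReal.ofReal (-u x)).toReal • Complex.exp (⟪x, w⟫ * Complex.I) =
          ((u x * Real.cos ⟪x, w⟫ : ℝ) : ℂ) + ((u x * Real.sin ⟪x, w⟫ : ℝ) : ℂ) * Complex.I := by
        intro x
        rw [← sub_smul, ENNReal.toReal_ofReal', ENNReal.toReal_ofReal',
          max_zero_sub_eq_self, Complex.exp_mul_I, Complex.real_smul]
        push_cast; ring
      simp_rw [this]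
      have b1 : Integrable (fun x => u x * Real.cos ⟪x, w⟫) μ :=
        hu.mul_bdd (c := 1) (Continuous.aestronglyMeasurable (by fun_prop))
          (Filter.Eventually.of_forall fun x => Real.abs_cos_le_one _)
      have b2 : Integrable (fun x => u x * Real.sin ⟪x, w⟫) μ :=
        hu.mul_bdd (c := 1) (Continuous.aestronglyMeasurable (by fun_prop))
          (Filter.Eventually.of_forall fun x => Real.abs_sin_le_one _)
      rw [integral_add b1.ofReal (b2.ofReal.mul_const _), integral_mul_const]
      have c1 : ∫ x, ((u x * Real.cos ⟪x, w⟫ : ℝ) : ℂ) ∂μ = 0 := by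
        rw [integral_complex_ofReal, Hc]; simp
      have c2 : ∫ x, ((u x * Real.sin ⟪x, w⟫ : ℝ) : ℂ) ∂μ = 0 := by
        rw [integral_complex_ofReal, Hs]; simp
      exact (show (∫ x, ((u x * Real.cos ⟪x, w⟫ : ℝ) : ℂ) ∂μ) +
        (∫ x, ((u x * Real.sin ⟪x, w⟫ : ℝ) : ℂ) ∂μ) * Complex.I = 0 by rw [c1, c2]; simp)
    · exact hbd (by simpa [ENNReal.toReal_ofReal'] using hu.pos_part)
    · exact hbd (by simpa [ENNReal.toReal_ofReal'] using hu.neg_part)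
  have hae := (withDensity_eq_iff hm1 hm2 ?_).1 heq
  · filter_upwards [hae] with x hx
    have := congrArg ENNReal.toReal hx
    rw [ENNReal.toReal_ofReal', ENNReal.toReal_ofReal'] at this
    have h := max_zero_sub_eq_self (u x)
    rw [this, sub_self] at h
    simpa using h.symm
  · exact hu.lintegral_lt_top.ne

/-! ### The core uniqueness result -/

lemma vu_core {Ω : Set E2} (hΩ : IsOpen Ω) (hcv : Convex ℝ Ω) (hb : Bornology.IsBounded Ω)
    {c : E2} (hc : c ∈ Ω) {u h ρ : E2 → ℝ} (hu : MemLp u 2 (volume.restrict Ω))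
    (hh : MemLp h 2 (volume.restrict Ω)) (hρ : MemLp ρ 2 (volume.restrict Ω))
    (H1 : ∀ φ : E2 → ℝ, ContDiff ℝ (⊤ : ℕ∞) φ → HasCompactSupport φ →
      ∫ x in Ω, u x * lap φ x = ∫ x in Ω, h x * φ x)
    (H2 : ∀ φ : E2 → ℝ, ContDiff ℝ (⊤ : ℕ∞) φ → HasCompactSupport φ → tsupport φ ⊆ Ω →
      ∫ x in Ω, u x * lap (lap φ) x = ∫ x in Ω, ρ x * φ x)
    (H3 : ∫ x in Ω, ρ x * u x = 0) : u =ᵐ[volume.restrict Ω] 0 := by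
  have hfin : IsFiniteMeasure (volume.restrict Ω) :=
    ⟨by simpa using hb.measure_lt_top⟩
  have hu1 := hu.integrable (by norm_num)
  have hh1 := hh.integrable (by norm_num)
  let l : ℕ → ℝ := fun n => 1 - 1 / ((n : ℝ) + 2)
  have hl2 : ∀ n, 1 / 2 ≤ l n := by
    intro n
    have : 1 / ((n : ℝ) + 2) ≤ 1 / 2 :=
      one_div_le_one_div_of_le (by norm_num) (by linarith [(Nat.cast_nonneg n : (0:ℝ) ≤ n)])
    simp only [l]; linarith
  have hl1 : ∀ n, l n < 1 := by
    intro n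
    have : 0 < 1 / ((n : ℝ) + 2) := by positivity
    simp only [l]; linarith
  have hl : Filter.Tendsto l Filter.atTop (nhds 1) := by
    have h1 : Filter.Tendsto (fun n : ℕ => 1 / ((n : ℝ) + 2)) Filter.atTop (nhds 0) := by
      refine Filter.Tendsto.div_atTop tendsto_const_nhds ?_
      exact Filter.tendsto_atTop_add_const_right _ _ tendsto_natCast_atTop_atTop
    simpa [l] using h1.const_sub 1
  let a : ℕ → E2 := fun n => (1 - l n) • c
  have ha : Filter.Tendsto a Filter.atTop (nhds 0) := by
    have := (hl.const_sub 1).smul_const c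
    simpa [a] using this
  have hK : ∀ n, IsCompact ((fun z => a n + l n • z) '' closure Ω) := by
    intro n
    exact hb.isCompact_closure.image (by fun_prop)
  have hKΩ : ∀ n, ((fun z => a n + l n • z) '' closure Ω) ⊆ Ω := by
    rintro n _ ⟨z, hz, rfl⟩
    have := hcv.combo_closure_interior_mem_interior (x := z) (y := c) hz
      (by rwa [hΩ.interior_eq]) (a := l n) (b := 1 - l n) (by linarith [hl2 n])
      (by linarith [hl1 n]) (by ring)
    rw [hΩ.interior_eq, add_comm] at this
    exact this
  choose δ hδ0 hδ using fun n => (hK n).exists_cthickening_subset_open hΩ (hKΩ n)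
  have hr0 : ∀ n : ℕ, 0 < min (δ n) (1 / ((n : ℝ) + 1)) := fun n =>
    lt_min (hδ0 n) (by positivity)
  let b : ℕ → ContDiffBump (0 : E2) := fun n =>
    ⟨min (δ n) (1 / ((n : ℝ) + 1)) / 2, min (δ n) (1 / ((n : ℝ) + 1)), half_pos (hr0 n),
      half_lt_self (hr0 n)⟩
  have hbt : Filter.Tendsto (fun n => (b n).rOut) Filter.atTop (nhds 0) := by
    refine squeeze_zero (fun n => (hr0 n).le) (fun n => min_le_right _ _)
      tendsto_one_div_add_atTop_nhds_zero_nat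
  -- the identity for each `n`
  have key : ∀ n, (l n ^ 2)⁻¹ * (∫ x in Ω, h x * ∫ z in Ω, h z * vuK (b n) (a n) (l n) x z) =
      ∫ x in Ω, ρ x * ∫ z in Ω, u z * vuK (b n) (a n) (l n) x z := by
    intro n
    have hln : l n ≠ 0 := by linarith [hl2 n]
    set K := (b n).normed volume with hKdef
    have hKs : ContDiff ℝ (⊤ : ℕ∞) K := vu_normed_smooth (b n)
    have hKc : HasCompactSupport K := (b n).hasCompactSupport_normed
    let m : E2 → E2 := fun z => a n + l n • z
    have hm : Continuous m := by fun_prop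
    let φ : E2 → ℝ := fun x => ∫ z in Ω, u z * K (x - m z)
    have hφ : ContDiff ℝ (⊤ : ℕ∞) φ := vu_F_smooth hu1 hm hKs hKc
    have hsupp : tsupport φ ⊆ Metric.cthickening (δ n) (m '' closure Ω) := by
      refine closure_minimal ?_ Metric.isClosed_cthickening
      intro x hx
      by_contra hnx
      apply hx
      refine setIntegral_eq_zero_of_forall_eq_zero fun z hz => ?_
      have : K (x - m z) = 0 := by
        by_contra hne
        have hmem : x - m z ∈ Function.support K := hne
        rw [hKdef, (b n).support_normed_eq] at hmem
        apply hnx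
        refine Metric.mem_cthickening_of_dist_le x (m z) _ _ ⟨z, subset_closure hz, rfl⟩ ?_
        rw [dist_eq_norm]
        have h1 : ‖x - m z‖ < min (δ n) (1 / ((n : ℝ) + 1)) := by
          have h2 : ‖x - m z‖ < (b n).rOut := by simpa using hmem
          exact h2
        exact h1.le.trans (min_le_left _ _)
      rw [this, mul_zero]
    have hφc : HasCompactSupport φ :=
      (hK n).cthickening.of_isClosed_subset (isClosed_tsupport _) hsupp
    have hφΩ : tsupport φ ⊆ Ω := hsupp.trans (hδ n)
    have e1 := H2 φ hφ hφc hφΩ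
    rw [H1 (lap φ) (vu_lap_smooth hφ) (vu_lap_compact hφc)] at e1
    have e2 : ∀ x, lap φ x = (l n ^ 2)⁻¹ * ∫ z in Ω, h z * vuK (b n) (a n) (l n) x z := by
      intro x
      have h1 : lap φ x = ∫ z in Ω, u z * lap K (x - m z) := vu_F_lap hu1 hm hKs hKc x
      have hfun : (fun z => vuK (b n) (a n) (l n) x z) = fun z => K ((x - a n) - l n • z) := by
        funext z; simp only [vuK, hKdef, sub_sub]
      have hemb : HasCompactSupport (fun z => vuK (b n) (a n) (l n) x z) := by
        rw [hfun]
        have hcl : Topology.IsClosedEmbedding (fun z : E2 => (x - a n) - l n • z) :=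
          ((Homeomorph.smulOfNeZero (l n) hln).trans
            (Homeomorph.subLeft (x - a n))).isClosedEmbedding
        exact hKc.comp_isClosedEmbedding hcl
      have hsm : ContDiff ℝ (⊤ : ℕ∞) (fun z => vuK (b n) (a n) (l n) x z) := by
        rw [hfun]
        exact hKs.comp (by fun_prop)
      have h2 := H1 _ hsm hemb
      rw [← h2, h1, ← integral_const_mul]
      congr 1; funext z
      rw [hfun, vu_lap_homothety hKs]
      simp only [m, sub_sub]
      field_simp
    simp_rw [e2] at e1
    rw [← integral_const_mul, show (∫ x in Ω, ρ x * ∫ z in Ω, u z * vuK (b n) (a n) (l n) x z) =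
      ∫ x in Ω, ρ x * φ x from rfl, ← e1]
    congr 1; funext x; ring
  have lim1 := vu_lim hΩ hh hh b a l hbt ha hl hl2
  have lim2 := vu_lim hΩ hρ hu b a l hbt ha hl hl2
  have lim3 := ((hl.pow 2).inv₀ (by norm_num)).mul lim1
  have heq := tendsto_nhds_unique (lim3.congr key) lim2
  rw [H3] at heq
  have hz : ∫ x in Ω, h x ^ 2 = 0 := by
    simpa [sq] using heq
  have hh0 : h =ᵐ[volume.restrict Ω] 0 := by
    have := (integral_eq_zero_iff_of_nonneg (fun x => sq_nonneg (h x)) hh.integrable_sq).1 hz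
    filter_upwards [this] with x hx
    simpa using hx
  refine vu_zero hΩ.measurableSet hb hu1 fun φ hφ hφc => ?_
  rw [H1 φ hφ hφc]
  refine integral_eq_zero_of_ae ?_
  filter_upwards [hh0] with x hx
  simp [hx]

/-! ### Polynomials -/

lemma vu_poly_sub {m : ℤ} {u v : E2 → ℝ} (hu : IsPoly2DegLe m u) (hv : IsPoly2DegLe m v) :
    IsPoly2DegLe m (fun x => u x - v x) := by
  obtain ⟨P, hP, hP'⟩ := hu
  obtain ⟨Q, hQ, hQ'⟩ := hv
  refine ⟨P - Q, fun d hd => ?_, fun x => ?_⟩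
  · rw [MvPolynomial.coeff_sub, hP d hd, hQ d hd, sub_zero]
  · show u x - v x = _
    rw [map_sub, ← hP', ← hQ']

lemma vu_poly_cont {m : ℤ} {u : E2 → ℝ} (hu : IsPoly2DegLe m u) : Continuous u := by
  obtain ⟨P, -, hP'⟩ := hu
  have : u = fun x : E2 => MvPolynomial.eval (fun i => x i) P := funext hP'
  rw [this]
  exact (MvPolynomial.continuous_eval P).comp (by fun_prop)

lemma vu_cont_memLp {Ω : Set E2} (hb : Bornology.IsBounded Ω) (hm : MeasurableSet Ω)
    {u : E2 → ℝ} (hu : Continuous u) :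
    MemLp u 2 (volume.restrict Ω) := by
  have hfin : IsFiniteMeasure (volume.restrict Ω) := ⟨by simpa using hb.measure_lt_top⟩
  obtain ⟨C, hC⟩ := hb.isCompact_closure.exists_bound_of_continuousOn hu.continuousOn
  refine MemLp.of_bound hu.aestronglyMeasurable C ?_
  filter_upwards [ae_restrict_mem hm] with x hx
  exact hC x (subset_closure hx)

lemma vu_poly_comp {m : ℤ} {u : E2 → ℝ} (hu : IsPoly2DegLe m u) {B : E2 → E2}
    {c : Fin 2 → ℝ} {M : Fin 2 → Fin 2 → ℝ}
    (hB : ∀ y i, B y i = c i + M i 0 * y 0 + M i 1 * y 1) :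
    IsPoly2DegLe m (fun y => u (B y)) := by
  obtain ⟨Q, hQ, hQ'⟩ := hu
  let g : Fin 2 → MvPolynomial (Fin 2) ℝ := fun i =>
    MvPolynomial.C (c i) + MvPolynomial.C (M i 0) * MvPolynomial.X 0 +
      MvPolynomial.C (M i 1) * MvPolynomial.X 1
  have hg : ∀ i, (g i).totalDegree ≤ 1 := by
    intro i
    refine (MvPolynomial.totalDegree_add _ _).trans (max_le
      ((MvPolynomial.totalDegree_add _ _).trans (max_le ?_ ?_)) ?_)
    · simp
    · refine (MvPolynomial.totalDegree_mul _ _).trans ?_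
      simp
    · refine (MvPolynomial.totalDegree_mul _ _).trans ?_
      simp
  have hdeg : ∀ d ∈ Q.support, ((d 0 + d 1 : ℕ) : ℤ) ≤ m := by
    intro d hd
    by_contra hlt
    exact (MvPolynomial.mem_support_iff.1 hd) (hQ d (not_le.1 hlt))
  have hform : MvPolynomial.aeval g Q =
      ∑ d ∈ Q.support, MvPolynomial.C (MvPolynomial.coeff d Q) * ∏ i, g i ^ d i := by
    rw [MvPolynomial.aeval_def, MvPolynomial.eval₂_eq']; rfl
  have htd : (MvPolynomial.aeval g Q).totalDegree ≤ m.toNat := by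
    rw [hform]
    refine MvPolynomial.totalDegree_finsetSum_le fun d hd => ?_
    refine (MvPolynomial.totalDegree_mul _ _).trans ?_
    rw [MvPolynomial.totalDegree_C, zero_add]
    refine (MvPolynomial.totalDegree_finsetProd _ _).trans ?_
    have h1 : ∀ i, (g i ^ d i).totalDegree ≤ d i := fun i =>
      (MvPolynomial.totalDegree_pow _ _).trans (by nlinarith [hg i])
    rw [Fin.sum_univ_two]
    have := hdeg d hd
    have := h1 0
    have := h1 1
    omega
  refine ⟨MvPolynomial.aeval g Q, fun d hd => ?_, fun y => ?_⟩
  · by_cases hm : m < 0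
    · have : Q.support = ∅ := by
        refine Finset.eq_empty_of_forall_notMem fun e he => ?_
        have := hdeg e he
        omega
      rw [hform, this]; simp
    · by_contra hne
      have := MvPolynomial.le_totalDegree (MvPolynomial.mem_support_iff.2 hne)
      rw [Finsupp.sum_fintype _ _ (fun _ => rfl), Fin.sum_univ_two] at this
      omega
  · show u (B y) = _
    rw [hQ', hform, map_sum, MvPolynomial.eval_eq']
    refine Finset.sum_congr rfl fun d _ => ?_
    simp [hB, g]

/-! ### The affine map -/

/-- the affine map is a homeomorphism with all the properties needed -/
lemma vu_affine (p : Fin 3 → E2) (hp : ccw p) :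
    ∃ L : E2 ≃L[ℝ] E2, ∀ x, affMap p x = p 0 + L x := by
  let L0 : E2 →ₗ[ℝ] E2 :=
    { toFun := fun x => x 0 • (p 1 - p 0) + x 1 • (p 2 - p 0)
      map_add' := fun x y => by simp only [PiLp.add_apply, add_smul]; abel
      map_smul' := fun r x => by
        simp only [PiLp.smul_apply, smul_eq_mul, RingHom.id_apply, smul_add, smul_smul] }
  have hinj : Function.Injective L0 := by
    rw [← LinearMap.ker_eq_bot, LinearMap.ker_eq_bot']
    intro x hx
    have h0 : x 0 • (p 1 - p 0) + x 1 • (p 2 - p 0) = 0 := hx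
    have e0 := congrArg (fun w : E2 => w 0) h0
    have e1 := congrArg (fun w : E2 => w 1) h0
    simp only [PiLp.add_apply, PiLp.smul_apply, smul_eq_mul, PiLp.zero_apply] at e0 e1
    unfold ccw at hp
    set D := (p 1 - p 0) 0 * (p 2 - p 0) 1 - (p 1 - p 0) 1 * (p 2 - p 0) 0 with hD
    have a0 : x 0 * D = 0 := by rw [hD]; linear_combination (p 2 - p 0) 1 * e0 - (p 2 - p 0) 0 * e1
    have a1 : x 1 * D = 0 := by rw [hD]; linear_combination (p 1 - p 0) 0 * e1 - (p 1 - p 0) 1 * e0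
    ext i
    fin_cases i
    · simpa [hp.ne'] using a0
    · simpa [hp.ne'] using a1
  refine ⟨(LinearEquiv.ofInjectiveEndo L0 hinj).toContinuousLinearEquiv, fun x => ?_⟩
  have : (LinearEquiv.ofInjectiveEndo L0 hinj).toContinuousLinearEquiv x = L0 x := rfl
  rw [this, affMap, add_assoc]; rfl

/-- the homeomorphism `x ↦ a + L x` -/
def vuHom (a : E2) (L : E2 ≃L[ℝ] E2) : E2 ≃ₜ E2 := L.toHomeomorph.trans (Homeomorph.addLeft a)

lemma vuHom_apply (a : E2) (L : E2 ≃L[ℝ] E2) (x : E2) : vuHom a L x = a + L x := rfl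

lemma vuHom_symm (a : E2) (L : E2 ≃L[ℝ] E2) (y : E2) :
    (vuHom a L).symm y = L.symm (y - a) := by
  rw [Homeomorph.symm_apply_eq, vuHom_apply, ContinuousLinearEquiv.apply_symm_apply]; abel

lemma vu_tri_preimage (p : Fin 3 → E2) {L : E2 ≃L[ℝ] E2} (hL : ∀ x, affMap p x = p 0 + L x) :
    vuHom (p 0) L ⁻¹' tri p = tri refTri := by
  have him : vuHom (p 0) L '' tri refTri = tri p := by
    unfold tri
    rw [Homeomorph.image_interior]
    let Af : E2 →ᵃ[ℝ] E2 := (L : E2 →ₗ[ℝ] E2).toAffineMap + AffineMap.const ℝ E2 (p 0)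
    have hAf : ⇑(vuHom (p 0) L) = Af := by
      funext x; rw [vuHom_apply, add_comm]; rfl
    rw [hAf, Af.image_convexHull, ← range_comp]
    congr 2
    congr 1
    funext i
    have h1 : Af (refTri i) = affMap p (refTri i) := by
      rw [hL, ← hAf, vuHom_apply]
    simp only [Function.comp]
    rw [h1]
    fin_cases i <;> simp [affMap, refTri]
  rw [← him, preimage_image_eq _ (vuHom (p 0) L).injective]

lemma vu_map_measure (p : Fin 3 → E2) {L : E2 ≃L[ℝ] E2} (hL : ∀ x, affMap p x = p 0 + L x) :
    ∃ C : ENNReal, C ≠ 0 ∧ C ≠ ⊤ ∧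
      Measure.map (vuHom (p 0) L) (volume.restrict (tri refTri)) =
        C • volume.restrict (tri p) := by
  have hdet : LinearMap.det (L : E2 →ₗ[ℝ] E2) ≠ 0 := L.toLinearEquiv.isUnit_det'.ne_zero
  refine ⟨ENNReal.ofReal |(LinearMap.det (L : E2 →ₗ[ℝ] E2))⁻¹|, ?_, ENNReal.ofReal_ne_top, ?_⟩
  · simpa using hdet
  have h1 : Measure.map (vuHom (p 0) L) volume =
      ENNReal.ofReal |(LinearMap.det (L : E2 →ₗ[ℝ] E2))⁻¹| • (volume : Measure E2) := by
    have e : ⇑(vuHom (p 0) L) = (fun y => p 0 + y) ∘ (L : E2 →ₗ[ℝ] E2) := by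
      funext x; rfl
    rw [e, ← Measure.map_map (measurable_const_add _)
        (show Measurable ⇑(L : E2 →ₗ[ℝ] E2) from L.continuous.measurable),
      Measure.map_linearMap_addHaar_eq_smul_addHaar volume hdet, Measure.map_smul,
      map_add_left_eq_self]
  have h2 := MeasurableEquiv.restrict_map (vuHom (p 0) L).toMeasurableEquiv volume (tri p)
  rw [Homeomorph.toMeasurableEquiv_coe, vu_tri_preimage p hL, h1, Measure.restrict_smul] at h2
  exact h2.symm

/-! ### Directional derivatives -/

lemma vu_mul_int {Ω : Set E2} {u φ : E2 → ℝ} (hu : MemLp u 2 (volume.restrict Ω))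
    (hφ : Continuous φ) (hc : HasCompactSupport φ) :
    Integrable (fun x => u x * φ x) (volume.restrict Ω) :=
  MemLp.integrable_mul (p := 2) (q := 2) hu (hφ.memLp_of_hasCompactSupport hc)

lemma vu_dir {Ω : Set E2} {u : E2 → ℝ} {G : Fin 2 → E2 → ℝ}
    (hu : MemLp u 2 (volume.restrict Ω)) (hG : ∀ d, MemLp (G d) 2 (volume.restrict Ω))
    (H : ∀ φ : E2 → ℝ, ContDiff ℝ (⊤ : ℕ∞) φ → HasCompactSupport φ → ∀ d : Fin 2,
      ∫ x in Ω, u x * fderiv ℝ φ x (stdb2 d) = - ∫ x in Ω, G d x * φ x)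
    (v : E2) {φ : E2 → ℝ} (hφ : ContDiff ℝ (⊤ : ℕ∞) φ) (hc : HasCompactSupport φ) :
    ∫ x in Ω, u x * fderiv ℝ φ x v = - ∫ x in Ω, (v 0 * G 0 x + v 1 * G 1 x) * φ x := by
  have hv : v = v 0 • stdb2 0 + v 1 • stdb2 1 := by
    ext i; fin_cases i <;> simp [stdb2]
  have e1 : ∀ x, u x * fderiv ℝ φ x v =
      v 0 * (u x * fderiv ℝ φ x (stdb2 0)) + v 1 * (u x * fderiv ℝ φ x (stdb2 1)) := by
    intro x
    conv_lhs => rw [hv]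
    rw [map_add, map_smul, map_smul, smul_eq_mul, smul_eq_mul]; ring
  have e2 : ∀ x, (v 0 * G 0 x + v 1 * G 1 x) * φ x =
      v 0 * (G 0 x * φ x) + v 1 * (G 1 x * φ x) := fun x => by ring
  simp_rw [e1, e2]
  have i1 : ∀ d, Integrable (fun x => u x * fderiv ℝ φ x (stdb2 d)) (volume.restrict Ω) := fun d =>
    vu_mul_int hu (vu_dd_smooth hφ _).continuous (hc.fderiv_apply ℝ _)
  have i2 : ∀ d, Integrable (fun x => G d x * φ x) (volume.restrict Ω) := fun d =>
    vu_mul_int (hG d) hφ.continuous hc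
  rw [integral_add ((i1 0).const_mul _) ((i1 1).const_mul _),
    integral_add ((i2 0).const_mul _) ((i2 1).const_mul _)]
  simp only [integral_const_mul, H φ hφ hc]
  ring

lemma vu_dir2 {Ω : Set E2} {u : E2 → ℝ} {G : Fin 2 → E2 → ℝ} {Hs : Fin 2 → Fin 2 → E2 → ℝ}
    (hu : MemLp u 2 (volume.restrict Ω)) (hG : ∀ d, MemLp (G d) 2 (volume.restrict Ω))
    (hHs : ∀ d d', MemLp (Hs d d') 2 (volume.restrict Ω))
    (H : ∀ φ : E2 → ℝ, ContDiff ℝ (⊤ : ℕ∞) φ → HasCompactSupport φ → ∀ d : Fin 2,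
      ∫ x in Ω, u x * fderiv ℝ φ x (stdb2 d) = - ∫ x in Ω, G d x * φ x)
    (H' : ∀ d', ∀ φ : E2 → ℝ, ContDiff ℝ (⊤ : ℕ∞) φ → HasCompactSupport φ → ∀ d : Fin 2,
      ∫ x in Ω, G d' x * fderiv ℝ φ x (stdb2 d) = - ∫ x in Ω, Hs d' d x * φ x)
    (v : E2) : ∃ h : E2 → ℝ, MemLp h 2 (volume.restrict Ω) ∧
      ∀ φ : E2 → ℝ, ContDiff ℝ (⊤ : ℕ∞) φ → HasCompactSupport φ →
      ∫ x in Ω, u x * fderiv ℝ (fun y => fderiv ℝ φ y v) x v = ∫ x in Ω, h x * φ x := by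
  have hK : ∀ d, MemLp (fun x => v 0 * Hs d 0 x + v 1 * Hs d 1 x) 2 (volume.restrict Ω) :=
    fun d => ((hHs d 0).const_mul _).add ((hHs d 1).const_mul _)
  refine ⟨fun x => v 0 * (v 0 * Hs 0 0 x + v 1 * Hs 0 1 x) +
    v 1 * (v 0 * Hs 1 0 x + v 1 * Hs 1 1 x),
    ((hK 0).const_mul _).add ((hK 1).const_mul _), fun φ hφ hc => ?_⟩
  rw [vu_dir hu hG H v (vu_dd_smooth hφ v) (hc.fderiv_apply ℝ v)]
  have e1 : ∀ x, (v 0 * G 0 x + v 1 * G 1 x) * fderiv ℝ φ x v =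
      v 0 * (G 0 x * fderiv ℝ φ x v) + v 1 * (G 1 x * fderiv ℝ φ x v) := fun x => by ring
  have e2 : ∀ x, (v 0 * (v 0 * Hs 0 0 x + v 1 * Hs 0 1 x) +
      v 1 * (v 0 * Hs 1 0 x + v 1 * Hs 1 1 x)) * φ x =
      v 0 * ((v 0 * Hs 0 0 x + v 1 * Hs 0 1 x) * φ x) +
      v 1 * ((v 0 * Hs 1 0 x + v 1 * Hs 1 1 x) * φ x) := fun x => by ring
  simp_rw [e1, e2]
  have i1 : ∀ d, Integrable (fun x => G d x * fderiv ℝ φ x v) (volume.restrict Ω) := fun d =>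
    vu_mul_int (hG d) (vu_dd_smooth hφ _).continuous (hc.fderiv_apply ℝ _)
  have i2 : ∀ d, Integrable (fun x => (v 0 * Hs d 0 x + v 1 * Hs d 1 x) * φ x)
      (volume.restrict Ω) := fun d => vu_mul_int (hK d) hφ.continuous hc
  rw [integral_add ((i1 0).const_mul _) ((i1 1).const_mul _),
    integral_add ((i2 0).const_mul _) ((i2 1).const_mul _)]
  simp only [integral_const_mul, vu_dir (hG 0) (hHs 0) (H' 0) v hφ hc,
    vu_dir (hG 1) (hHs 1) (H' 1) v hφ hc]
  ring

/-- two functions with the same face trace: the difference satisfies integration by parts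
without boundary term -/
lemma vu_trace_sub {p : Fin 3 → E2} {u₁ u₂ : E2 → ℝ} {D₁ D₂ : Fin 2 → E2 → ℝ}
    {bu : Fin 3 → ℝ → ℝ} (h1 : HasFaceTrace p u₁ D₁ bu) (h2 : HasFaceTrace p u₂ D₂ bu)
    (m1 : MemLp u₁ 2 (volume.restrict (tri p))) (m2 : MemLp u₂ 2 (volume.restrict (tri p)))
    (n1 : ∀ d, MemLp (D₁ d) 2 (volume.restrict (tri p)))
    (n2 : ∀ d, MemLp (D₂ d) 2 (volume.restrict (tri p)))
    (φ : E2 → ℝ) (hφ : ContDiff ℝ (⊤ : ℕ∞) φ) (hc : HasCompactSupport φ) (d : Fin 2) :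
    ∫ x in tri p, (u₁ x - u₂ x) * fderiv ℝ φ x (stdb2 d) =
      - ∫ x in tri p, (D₁ d x - D₂ d x) * φ x := by
  have e := (h1 φ hφ hc d).trans (h2 φ hφ hc d).symm
  have hs : Continuous (fun x => fderiv ℝ φ x (stdb2 d)) := (vu_dd_smooth hφ _).continuous
  have a1 := vu_mul_int m1 hs (hc.fderiv_apply ℝ _)
  have a2 := vu_mul_int m2 hs (hc.fderiv_apply ℝ _)
  have b1 := vu_mul_int (n1 d) hφ.continuous hc
  have b2 := vu_mul_int (n2 d) hφ.continuous hc
  rw [integral_add a1 b1, integral_add a2 b2] at e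
  simp_rw [sub_mul]
  rw [integral_sub a1 a2, integral_sub b1 b2]
  linarith

theorem vem_unisolvence_general (k : ℕ) (hk : 3 ≤ k) (p : Fin 3 → E2) (hp : ccw p) :
    ∀ (ξ₁ ξ₂ : E2 → ℝ) (f g : Fin 3 → ℝ → ℝ),
      MemVEMgenT p k ξ₁ f g → MemVEMgenT p k ξ₂ f g →
      (∀ q : E2 → ℝ, IsPoly2DegLe ((k : ℤ) - 4) q →
        ∫ x in tri p, ξ₁ x * q x = ∫ x in tri p, ξ₂ x * q x) →
      ξ₁ =ᵐ[volume.restrict (tri p)] ξ₂ := by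
  intro ξ₁ ξ₂ f g h1 h2 hq
  obtain ⟨⟨fr₁, gr₁, -, -, -, -, -, -, ρ₁, hρ₁, B₁⟩, -, -, G₁, Hs₁, ⟨m₁, mG₁, mH₁⟩, ⟨t₁, tG₁⟩⟩ := h1
  obtain ⟨⟨fr₂, gr₂, -, -, -, -, -, -, ρ₂, hρ₂, B₂⟩, -, -, G₂, Hs₂, ⟨m₂, mG₂, mH₂⟩, ⟨t₂, tG₂⟩⟩ := h2
  unfold L2on at m₁ mG₁ mH₁ m₂ mG₂ mH₂
  obtain ⟨L, hL⟩ := vu_affine p hp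
  obtain ⟨C, hC0, hCt, hmap⟩ := vu_map_measure p hL
  set A := vuHom (p 0) L with hA
  have hAp : ∀ x, affMap p x = A x := fun x => by rw [hL, hA, vuHom_apply]
  have hemb : MeasurableEmbedding A := A.measurableEmbedding
  have hbr : Bornology.IsBounded (tri refTri) :=
    ((isBounded_convexHull).2 (finite_range refTri).isBounded).subset interior_subset
  have hbp : Bornology.IsBounded (tri p) :=
    ((isBounded_convexHull).2 (finite_range p).isBounded).subset interior_subset
  have hor : IsOpen (tri refTri) := isOpen_interior
  have hop : IsOpen (tri p) := isOpen_interior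
  have hintg : ∀ w : E2 → ℝ, ∫ x in tri refTri, w (A x) = C.toReal * ∫ y in tri p, w y := by
    intro w
    rw [← hemb.integral_map, hmap, integral_smul_measure, smul_eq_mul]
  have hLp : ∀ {w : E2 → ℝ}, MemLp w 2 (volume.restrict (tri p)) →
      MemLp (fun x => w (A x)) 2 (volume.restrict (tri refTri)) := by
    intro w hw
    have := hw.smul_measure hCt
    rw [← hmap] at this
    exact hemb.memLp_map_measure_iff.1 this
  suffices hmain : (fun x => ξ₁ (A x) - ξ₂ (A x)) =ᵐ[volume.restrict (tri refTri)] 0 by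
    have h3 : ∀ᵐ y ∂(Measure.map A (volume.restrict (tri refTri))), ξ₁ y - ξ₂ y = 0 :=
      hemb.ae_map_iff.2 hmain
    rw [hmap, Measure.ae_ennreal_smul_measure_eq hC0] at h3
    filter_upwards [h3] with y hy
    linarith
  rcases (tri refTri).eq_empty_or_nonempty with hemp | ⟨c, hc⟩
  · rw [hemp, Measure.restrict_empty]; simp [Filter.EventuallyEq]
  have mξ : MemLp (fun x => ξ₁ x - ξ₂ x) 2 (volume.restrict (tri p)) := m₁.sub m₂
  choose h hh2 hhI using vu_dir2 (Ω := tri p) (u := fun x => ξ₁ x - ξ₂ x)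
    (G := fun d x => G₁ d x - G₂ d x) (Hs := fun d d' x => Hs₁ d d' x - Hs₂ d d' x)
    mξ (fun d => (mG₁ d).1.sub (mG₂ d).1) (fun d d' => (mH₁ d d').1.sub (mH₂ d d').1)
    (vu_trace_sub t₁ t₂ m₁ m₂ (fun d => (mG₁ d).1) (fun d => (mG₂ d).1))
    (fun d => vu_trace_sub (tG₁ d) (tG₂ d) (mG₁ d).1 (mG₂ d).1 (fun d' => (mH₁ d d').1)
      (fun d' => (mH₂ d d').1))
  have hAd : ∀ x, HasFDerivAt A (L : E2 →L[ℝ] E2) x := fun x =>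
    (L.hasFDerivAt (x := x)).const_add (p 0)
  have hAsm : ContDiff ℝ (⊤ : ℕ∞) A := contDiff_const.add L.contDiff
  have hAi : ContDiff ℝ (⊤ : ℕ∞) A.symm := by
    have : ⇑A.symm = fun y => L.symm (y - p 0) := funext fun y => vuHom_symm _ _ y
    rw [this]
    exact L.symm.contDiff.comp (contDiff_id.sub contDiff_const)
  have hρ := vu_poly_sub hρ₁ hρ₂
  refine vu_core hor (convex_convexHull ℝ _).interior hbr hc
    (h := fun x => (fun y => h (L (stdb2 0)) y + h (L (stdb2 1)) y) (A x))
    (ρ := fun x => ρ₁ x - ρ₂ x) (hLp mξ) (hLp ((hh2 _).add (hh2 _)))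
    (vu_cont_memLp hbr hor.measurableSet (vu_poly_cont hρ)) ?_ ?_ ?_
  · intro φ hφ hφc
    set ψ : E2 → ℝ := fun y => φ (A.symm y) with hψ
    have hψs : ContDiff ℝ (⊤ : ℕ∞) ψ := hφ.comp hAi
    have hψc : HasCompactSupport ψ := hφc.comp_homeomorph A.symm
    have hφψ : φ = fun x => ψ (A x) := by funext x; simp [hψ]
    have el : ∀ x, lap φ x = (fun y => fderiv ℝ (fun y => fderiv ℝ ψ y (L (stdb2 0))) y (L (stdb2 0)) +
        fderiv ℝ (fun y => fderiv ℝ ψ y (L (stdb2 1))) y (L (stdb2 1))) (A x) := by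
      intro x
      rw [hφψ, vu_lap_affine hψs hAd, Fin.sum_univ_two]; rfl
    have l1 : ∫ x in tri refTri, (ξ₁ (A x) - ξ₂ (A x)) * lap φ x =
        C.toReal * ∫ y in tri p, ((ξ₁ y - ξ₂ y) *
          fderiv ℝ (fun y => fderiv ℝ ψ y (L (stdb2 0))) y (L (stdb2 0)) + (ξ₁ y - ξ₂ y) *
          fderiv ℝ (fun y => fderiv ℝ ψ y (L (stdb2 1))) y (L (stdb2 1))) := by
      refine Eq.trans ?_ (hintg _)
      congr 1; funext x; rw [el]; ring
    have l2 : ∫ x in tri refTri, (fun y => h (L (stdb2 0)) y + h (L (stdb2 1)) y) (A x) * φ x =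
        C.toReal * ∫ y in tri p, (h (L (stdb2 0)) y * ψ y + h (L (stdb2 1)) y * ψ y) := by
      refine Eq.trans ?_ (hintg _)
      congr 1; funext x
      simp only [hψ, Homeomorph.symm_apply_apply]; ring
    rw [l1, l2]
    have i1 : ∀ v, Integrable (fun y => (ξ₁ y - ξ₂ y) *
        fderiv ℝ (fun y => fderiv ℝ ψ y v) y v) (volume.restrict (tri p)) := fun v =>
      vu_mul_int mξ (vu_dd_smooth (vu_dd_smooth hψs _) _).continuous
        ((hψc.fderiv_apply ℝ _).fderiv_apply ℝ _)
    have i2 : ∀ v, Integrable (fun y => h v y * ψ y) (volume.restrict (tri p)) := fun v =>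
      vu_mul_int (hh2 v) hψs.continuous hψc
    rw [integral_add (i1 _) (i1 _), integral_add (i2 _) (i2 _), hhI _ ψ hψs hψc, hhI _ ψ hψs hψc]
  · intro φ hφ hφc hφt
    have b1 := B₁ φ hφ hφc hφt
    have b2 := B₂ φ hφ hφc hφt
    simp only [hAp] at b1 b2
    have hl := vu_lap_smooth (vu_lap_smooth hφ)
    have hlc := vu_lap_compact (vu_lap_compact hφc)
    simp_rw [sub_mul]
    rw [integral_sub (vu_mul_int (hLp m₁) hl.continuous hlc)
      (vu_mul_int (hLp m₂) hl.continuous hlc), b1, b2, integral_sub]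
    · exact vu_mul_int (vu_cont_memLp hbr hor.measurableSet (vu_poly_cont hρ₁)) hφ.continuous hφc
    · exact vu_mul_int (vu_cont_memLp hbr hor.measurableSet (vu_poly_cont hρ₂)) hφ.continuous hφc
  · have hBs : ∀ y i, A.symm y i = -(L.symm (p 0) i) +
        (fun i j => L.symm (stdb2 j) i) i 0 * y 0 + (fun i j => L.symm (stdb2 j) i) i 1 * y 1 := by
      intro y i
      have hv : y = y 0 • stdb2 0 + y 1 • stdb2 1 := by
        ext i; fin_cases i <;> simp [stdb2]
      have h5 : A.symm y = L.symm (y - p 0) := vuHom_symm _ _ y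
      rw [h5, map_sub]
      conv_lhs => rw [hv]
      simp only [map_add, map_smul, PiLp.sub_apply, PiLp.add_apply, PiLp.smul_apply, smul_eq_mul]
      ring
    have hqp : IsPoly2DegLe ((k : ℤ) - 4) (fun y => ρ₁ (A.symm y) - ρ₂ (A.symm y)) :=
      vu_poly_comp hρ (B := A.symm) (c := fun i => -(L.symm (p 0) i))
        (M := fun i j => L.symm (stdb2 j) i) hBs
    have e := hq _ hqp
    have mq := vu_cont_memLp hbp hop.measurableSet (vu_poly_cont hqp)
    have e3 : ∫ x in tri refTri, (ρ₁ x - ρ₂ x) * (ξ₁ (A x) - ξ₂ (A x)) =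
        C.toReal * ∫ y in tri p, (ξ₁ y * (ρ₁ (A.symm y) - ρ₂ (A.symm y)) -
          ξ₂ y * (ρ₁ (A.symm y) - ρ₂ (A.symm y))) := by
      refine Eq.trans ?_ (hintg _)
      congr 1; funext x
      simp only [Homeomorph.symm_apply_apply]; ring
    have j1 : Integrable (fun y => ξ₁ y * (ρ₁ (A.symm y) - ρ₂ (A.symm y)))
        (volume.restrict (tri p)) := MemLp.integrable_mul (p := 2) (q := 2) m₁ mq
    have j2 : Integrable (fun y => ξ₂ y * (ρ₁ (A.symm y) - ρ₂ (A.symm y)))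
        (volume.restrict (tri p)) := MemLp.integrable_mul (p := 2) (q := 2) m₂ mq
    rw [e3, integral_sub j1 j2, e, sub_self, mul_zero]
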